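/- Let λ > 1 be a real number and let a1, a2, b1, b2 be positive real numbers. Then for all positive real numbers d1, d2 one has λ⁻¹·(d1·a1 + d2·b1)·(d1·a2 + d2·b2) < (λ·d1·a1 + d2·b1)·(λ⁻¹·d1·a2 + d2·b2) < λ·(d1·a1 + d2·b1)·(d1·a2 + d2·b2). -/

import Mathlib

/-- Coordinate form of Lemma 3.3 (ineqL1): for `λ > 1` and positive `a1 a2 b1 b2`,
for all positive `d1 d2`,
`λ⁻¹·L1(D) < L1(τ2·D) < λ·L1(D)` where `L1(D) = (d1·a1 + d2·b1)·(d1·a2 + d2·b2)`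
and `L1(τ2·D) = (λ·d1·a1 + d2·b1)·(λ⁻¹·d1·a2 + d2·b2)`. -/
theorem stmt_0 (lam a1 a2 b1 b2 : ℝ) (hlam : 1 < lam)
    (ha1 : 0 < a1) (ha2 : 0 < a2) (hb1 : 0 < b1) (hb2 : 0 < b2) :
    ∀ d1 d2 : ℝ, 0 < d1 → 0 < d2 →
      lam⁻¹ * ((d1 * a1 + d2 * b1) * (d1 * a2 + d2 * b2))
          < (lam * d1 * a1 + d2 * b1) * (lam⁻¹ * d1 * a2 + d2 * b2) ∧
      (lam * d1 * a1 + d2 * b1) * (lam⁻¹ * d1 * a2 + d2 * b2)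
          < lam * ((d1 * a1 + d2 * b1) * (d1 * a2 + d2 * b2)) := by
  intro d1 d2 hd1 hd2
  have hinv : lam⁻¹ < 1 := inv_lt_one_of_one_lt₀ hlam
  have hinv_pos : 0 < lam⁻¹ := by positivity
  have hp : 0 < d1 * a1 := by positivity
  have hq : 0 < d2 * b1 := by positivity
  have hr : 0 < d1 * a2 := by positivity
  have hs : 0 < d2 * b2 := by positivity
  have hlam_p : d1 * a1 < lam * (d1 * a1) := lt_mul_of_one_lt_left hp hlam
  have hlam_q : d2 * b1 < lam * (d2 * b1) := lt_mul_of_one_lt_left hq hlam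
  have hinv_r : lam⁻¹ * (d1 * a2) < d1 * a2 := mul_lt_of_lt_one_left hr hinv
  have hinv_s : lam⁻¹ * (d2 * b2) < d2 * b2 := mul_lt_of_lt_one_left hs hinv
  constructor
  · calc
      _ = (d1 * a1 + d2 * b1) * (lam⁻¹ * (d1 * a2 + d2 * b2)) := by ring
      _ < _ := mul_lt_mul'' (by linarith) (by linarith) (by positivity) (by positivity)
  · calc
      _ < (lam * (d1 * a1 + d2 * b1)) * (d1 * a2 + d2 * b2) :=
        mul_lt_mul'' (by linarith) (by linarith) (by positivity) (by positivity)
      _ = _ := by ring
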